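/- Let d ≥ 1, 1 ≤ p,q ≤ ∞ and let A, B be pairs of nonnegative reals. Let φ be a Schwartz function on ℝ^d such that φ̂ is smooth, nonnegative, supported in the unit cube, and φ does not vanish on the cube 1 + [0,1]^d. For a real sequence (c_n)_{n∈ℤ^d} with only finitely many nonzero terms, set f(x) = φ(x) Σ_{n∈ℤ^d} c_n e^{2πi⟨x,n⟩} and f_t(x) = f(x/t) for t > 0. Then, with implied constants depending only on φ, d, p, q, A, B (not on t or (c_n)): (i) ‖ x^A f_t ‖_q ≈ t^{A + d/q} ‖ Σ_n c_n e^{2πi⟨n,x⟩} ‖_{L^q([0,1]^d)}, where t^{A + d/q} = t^{A₁ + d/q} for t < 1 and t^{A₂ + d/q} for t ≥ 1; (ii) ‖ ξ^B f̂_t ‖_p ≈ t^{d/p′} ( Σ_n |c_n|^p ((1+|n|)/t)^{pB} )^{1/p}, where s^{pB} = s^{pB₁} for s < 1 and s^{pB₂} for s ≥ 1. -/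

import Mathlib

open MeasureTheory
open scoped ENNReal FourierTransform Real

/-- The broken power weight `x^A`: `|x|^{A₁}` for `|x| < 1`, `|x|^{A₂}` for `|x| ≥ 1`. -/
noncomputable def brokenWeight {d : ℕ} (A : ℝ × ℝ) (x : EuclideanSpace ℝ (Fin d)) : ℝ :=
  if ‖x‖ < 1 then ‖x‖ ^ A.1 else ‖x‖ ^ A.2

/-- Broken power of a positive real number `t`: `t^{E₁}` for `t < 1`, `t^{E₂}` for `t ≥ 1`. -/
noncomputable def brokenPow (E : ℝ × ℝ) (t : ℝ) : ℝ :=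
  if t < 1 then t ^ E.1 else t ^ E.2

/-- Euclidean norm of an integer lattice point `n ∈ ℤ^d`. -/
noncomputable def zNorm {d : ℕ} (n : Fin d → ℤ) : ℝ :=
  Real.sqrt (∑ i, ((n i : ℝ)) ^ 2)

/-- The lattice trigonometric series `Σ_n c_n e^{2πi⟨y,n⟩}`. -/
noncomputable def latticeSum {d : ℕ} (c : (Fin d → ℤ) → ℝ)
    (y : EuclideanSpace ℝ (Fin d)) : ℂ :=
  ∑ᶠ n : Fin d → ℤ, (c n : ℂ) *
    Complex.exp (2 * (π : ℂ) * Complex.I * (∑ i, (y i : ℂ) * (n i : ℂ)))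

/-- The lattice point `k ∈ ℤ^d`, as a vector of Euclidean space. -/
noncomputable def zVec {d : ℕ} (k : Fin d → ℤ) : EuclideanSpace ℝ (Fin d) :=
  WithLp.toLp 2 fun i => (k i : ℝ)

/-- The coordinatewise floor of a vector of Euclidean space. -/
noncomputable def floorVec {d : ℕ} (x : EuclideanSpace ℝ (Fin d)) : Fin d → ℤ :=
  fun i => ⌊x i⌋

/-- The half-open unit cube `[0,1)^d`. -/
def unitCell (d : ℕ) : Set (EuclideanSpace ℝ (Fin d)) :=
  {x | ∀ i, x i ∈ Set.Ico (0 : ℝ) 1}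

section Lattice

variable {d : ℕ}

@[simp] lemma zVec_apply (k : Fin d → ℤ) (i : Fin d) : zVec k i = k i := rfl

lemma norm_zVec (k : Fin d → ℤ) : ‖zVec k‖ = zNorm k := by
  simp [EuclideanSpace.norm_eq, zNorm]

lemma zNorm_nonneg (k : Fin d → ℤ) : 0 ≤ zNorm k := Real.sqrt_nonneg _

lemma measurable_floorVec : Measurable (floorVec (d := d)) :=
  measurable_pi_lambda _ fun i => Int.measurable_floor.comp (by fun_prop)

lemma measurableSet_unitCell : MeasurableSet (unitCell d) := by
  have : unitCell d = ⋂ i, (fun x : EuclideanSpace ℝ (Fin d) => x i) ⁻¹' Set.Ico (0 : ℝ) 1 := by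
    ext x; simp [unitCell]
  rw [this]
  exact MeasurableSet.iInter fun i => measurableSet_Ico.preimage (by fun_prop)

lemma volume_unitCell : volume (unitCell d) = 1 := by
  have h : unitCell d = (WithLp.ofLp : EuclideanSpace ℝ (Fin d) → Fin d → ℝ) ⁻¹'
      Set.pi Set.univ fun _ => Set.Ico (0 : ℝ) 1 := by
    ext x; simp [unitCell]
  rw [h, (PiLp.volume_preserving_ofLp (Fin d)).measure_preimage
    (MeasurableSet.univ_pi fun _ => measurableSet_Ico).nullMeasurableSet]
  simp [Real.volume_pi_Ico]

lemma floorVec_eq_iff {x : EuclideanSpace ℝ (Fin d)} {k : Fin d → ℤ} :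
    floorVec x = k ↔ x - zVec k ∈ unitCell d := by
  simp only [funext_iff, floorVec, Int.floor_eq_iff, unitCell, Set.mem_ofPred_eq, PiLp.sub_apply,
    zVec_apply, Set.mem_Ico]
  refine forall_congr' fun i => ?_
  constructor <;> rintro ⟨h1, h2⟩ <;> constructor <;> linarith

lemma sub_floorVec_mem (x : EuclideanSpace ℝ (Fin d)) :
    x - zVec (floorVec x) ∈ unitCell d :=
  floorVec_eq_iff.1 rfl

lemma norm_le_of_mem_unitCell {x : EuclideanSpace ℝ (Fin d)} (hx : x ∈ unitCell d) :
    ‖x‖ ≤ d := by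
  rw [EuclideanSpace.norm_eq]
  refine Real.sqrt_le_iff.2 ⟨by positivity, ?_⟩
  calc ∑ i, ‖x i‖ ^ 2 ≤ ∑ _i : Fin d, (1 : ℝ) := by
        refine Finset.sum_le_sum fun i _ => ?_
        have := hx i
        rw [Real.norm_eq_abs, sq_abs]
        nlinarith [this.1, this.2]
    _ = d := by simp
    _ ≤ (d : ℝ) ^ 2 := by exact_mod_cast Nat.le_self_pow two_ne_zero d

/-- Integration over the whole space, cell by cell. -/
lemma lintegral_eq_tsum_unitCell (F : EuclideanSpace ℝ (Fin d) → ℝ≥0∞) :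
    ∫⁻ x, F x = ∑' k : Fin d → ℤ, ∫⁻ u in unitCell d, F (u + zVec k) := by
  have hU : (⋃ k : Fin d → ℤ, floorVec (d := d) ⁻¹' {k}) = Set.univ := by
    ext x; simp
  rw [← setLIntegral_univ, ← hU, lintegral_iUnion
    (fun k => measurable_floorVec (measurableSet_singleton k))
    (fun j k hjk => Set.disjoint_left.2 fun x hj hk => hjk (hj.symm.trans hk))]
  refine tsum_congr fun k => ?_
  rw [← (measurePreserving_add_right volume (zVec k)).setLIntegral_comp_preimage_emb
    (measurableEmbedding_addRight _)]
  congr 2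
  ext x
  simp [floorVec_eq_iff]

/-- The coordinatewise floor pushes Lebesgue measure on the translates of a subset `S` of the
unit cell to a multiple of the counting measure. -/
lemma map_floorVec_restrict {S : Set (EuclideanSpace ℝ (Fin d))} (hSQ : S ⊆ unitCell d) :
    (volume.restrict {x | x - zVec (floorVec x) ∈ S}).map floorVec =
      volume S • Measure.count := by
  refine Measure.ext_of_singleton fun k => ?_
  have hk : MeasurableSet (floorVec (d := d) ⁻¹' {k}) :=
    measurable_floorVec (measurableSet_singleton k)
  rw [Measure.map_apply measurable_floorVec (measurableSet_singleton k),
    Measure.restrict_apply hk]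
  have : floorVec (d := d) ⁻¹' {k} ∩ {x | x - zVec (floorVec x) ∈ S}
      = (fun x => x + -zVec k) ⁻¹' S := by
    ext x
    simp only [Set.mem_inter_iff, Set.mem_preimage, Set.mem_singleton_iff, Set.mem_ofPred_eq,
      ← sub_eq_add_neg]
    constructor
    · rintro ⟨rfl, h⟩; exact h
    · intro h
      have := floorVec_eq_iff.2 (hSQ h)
      exact ⟨this, by rwa [this]⟩
  rw [this, measure_preimage_add_right]
  simp

/-- An `L^p` norm is bounded by the `ℓ^p` norm of a sequence that dominates it on cells. -/
lemma eLpNorm_le_count {F : EuclideanSpace ℝ (Fin d) → ℝ} {a : (Fin d → ℤ) → ℝ} {C : ℝ}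
    (p : ℝ≥0∞) (h : ∀ x, ‖F x‖ ≤ C * ‖a (floorVec x)‖) :
    eLpNorm F p volume ≤ ENNReal.ofReal C * eLpNorm a p Measure.count := by
  have hmap := map_floorVec_restrict (d := d) subset_rfl
  simp only [sub_floorVec_mem, Set.ofPred_true, Measure.restrict_univ, volume_unitCell,
    one_smul] at hmap
  rw [← hmap, eLpNorm_map_measure (Measurable.of_discrete.aestronglyMeasurable)
    measurable_floorVec.aemeasurable]
  exact eLpNorm_le_mul_eLpNorm_of_ae_le_mul (Filter.Eventually.of_forall h) p

/-- An `L^p` norm is bounded below by the `ℓ^p` norm of a sequence that is dominated by it on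
the translates of a fixed subset of the unit cell. -/
lemma count_le_eLpNorm {F : EuclideanSpace ℝ (Fin d) → ℝ} {a : (Fin d → ℤ) → ℝ} {C : ℝ}
    (p : ℝ≥0∞) {S : Set (EuclideanSpace ℝ (Fin d))} (hS : MeasurableSet S)
    (hSQ : S ⊆ unitCell d) (hS0 : volume S ≠ 0)
    (h : ∀ x, x - zVec (floorVec x) ∈ S → ‖a (floorVec x)‖ ≤ C * ‖F x‖) :
    volume S ^ (1 / p).toReal * eLpNorm a p Measure.count ≤
      ENNReal.ofReal C * eLpNorm F p volume := by
  rw [← smul_eq_mul, ← eLpNorm_smul_measure_of_ne_zero hS0, ← map_floorVec_restrict hSQ,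
    eLpNorm_map_measure (Measurable.of_discrete.aestronglyMeasurable)
    measurable_floorVec.aemeasurable]
  have hm : MeasurableSet {x : EuclideanSpace ℝ (Fin d) | x - zVec (floorVec x) ∈ S} := by
    have : Measurable fun x : EuclideanSpace ℝ (Fin d) => x - zVec (floorVec x) :=
      measurable_id.sub ((Measurable.of_discrete (f := zVec (d := d))).comp measurable_floorVec)
    exact this hS
  calc _ ≤ ENNReal.ofReal C * eLpNorm F p
        (volume.restrict {x | x - zVec (floorVec x) ∈ S}) :=
        eLpNorm_le_mul_eLpNorm_of_ae_le_mul ((ae_restrict_iff' hm).2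
          (Filter.Eventually.of_forall h)) p
    _ ≤ _ := by gcongr; exact Measure.restrict_le_self

lemma eLpNorm_comp_smul {G : Type*} [NormedAddCommGroup G] (p : ℝ≥0∞)
    (F : EuclideanSpace ℝ (Fin d) → G) {r : ℝ} (hr : 0 < r) :
    eLpNorm (fun x => F (r • x)) p volume =
      ENNReal.ofReal (r ^ (-((d : ℝ) * (1 / p).toReal))) * eLpNorm F p volume := by
  have h := (Homeomorph.smulOfNeZero (α := EuclideanSpace ℝ (Fin d)) r
    hr.ne').measurableEmbedding.eLpNorm_map_measure (μ := volume) (g := F) (p := p)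
  have h2 : eLpNorm F p (Measure.map (fun x => r • x) volume) =
      eLpNorm (fun x => F (r • x)) p volume := h
  rw [← h2, Measure.map_addHaar_smul _ hr.ne', eLpNorm_smul_measure_of_ne_zero (by
    simp only [ne_eq, ENNReal.ofReal_eq_zero, not_le]; positivity), smul_eq_mul,
    ENNReal.ofReal_rpow_of_nonneg (by positivity) (by positivity), finrank_euclideanSpace_fin,
    abs_of_pos (by positivity), Real.inv_rpow (by positivity), Real.rpow_neg hr.le,
    Real.rpow_mul hr.le, Real.rpow_natCast]

end Lattice

section Periodic

variable {d : ℕ}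

lemma one_add_norm_rpow_neg_le {E : Type*} [NormedAddCommGroup E] (x v : E) {r : ℝ}
    (hr : 0 ≤ r) :
    (1 + ‖x‖) ^ (-r) ≤ (1 + ‖v‖) ^ r * (1 + ‖x + v‖) ^ (-r) := by
  have h1 : 1 + ‖x + v‖ ≤ (1 + ‖v‖) * (1 + ‖x‖) := by
    nlinarith [norm_add_le x v, norm_nonneg x, norm_nonneg v,
      mul_nonneg (norm_nonneg x) (norm_nonneg v)]
  have h2 := Real.rpow_le_rpow (by positivity) h1 hr
  rw [Real.mul_rpow (by positivity) (by positivity)] at h2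
  rw [Real.rpow_neg (by positivity), Real.rpow_neg (by positivity), inv_le_iff_one_le_mul₀
    (by positivity), mul_comm, ← mul_assoc, ← div_eq_mul_inv, one_le_div (by positivity)]
  linarith [mul_comm ((1 + ‖v‖) ^ r) ((1 + ‖x‖) ^ r)]

lemma tsum_one_add_norm_zVec_lt_top :
    ∑' k : Fin d → ℤ, ENNReal.ofReal ((1 + ‖zVec k‖) ^ (-((d : ℝ) + 1))) < ∞ := by
  set r : ℝ := (d : ℝ) + 1
  have hr : 0 ≤ r := by positivity
  have hfin := finite_integral_one_add_norm (E := EuclideanSpace ℝ (Fin d)) (μ := volume)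
    (r := r) (by simp [r])
  rw [lintegral_eq_tsum_unitCell] at hfin
  have hle : ∀ k : Fin d → ℤ, ENNReal.ofReal ((1 + ‖zVec k‖) ^ (-r)) ≤
      ENNReal.ofReal ((1 + (d : ℝ)) ^ r) *
        ∫⁻ u in unitCell d, ENNReal.ofReal ((1 + ‖u + zVec k‖) ^ (-r)) := by
    intro k
    rw [← lintegral_const_mul' _ _ ENNReal.ofReal_ne_top]
    calc ENNReal.ofReal ((1 + ‖zVec k‖) ^ (-r))
        = ∫⁻ _u in unitCell d, ENNReal.ofReal ((1 + ‖zVec k‖) ^ (-r)) := by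
          simp [volume_unitCell]
      _ ≤ _ := by
          refine setLIntegral_mono' measurableSet_unitCell fun u hu => ?_
          rw [← ENNReal.ofReal_mul (by positivity)]
          refine ENNReal.ofReal_le_ofReal ((one_add_norm_rpow_neg_le (zVec k) u hr).trans ?_)
          rw [add_comm (zVec k)]
          gcongr
          exact norm_le_of_mem_unitCell hu
  refine (ENNReal.tsum_le_tsum hle).trans_lt ?_
  rw [ENNReal.tsum_mul_left]
  exact ENNReal.mul_lt_top ENNReal.ofReal_lt_top hfin

/-- A lattice-periodic function with a decaying factor is controlled by one period. -/
lemma exists_eLpNorm_mul_periodic_le (q : ℝ≥0∞) (hq : 1 ≤ q) :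
    ∃ C : ℝ, 0 < C ∧ ∀ L : EuclideanSpace ℝ (Fin d) → ℂ, (∀ k x, L (x + zVec k) = L x) →
      eLpNorm (fun x => (1 + ‖x‖) ^ (-((d : ℝ) + 1)) * ‖L x‖) q volume ≤
        ENNReal.ofReal C * eLpNorm L q (volume.restrict (unitCell d)) := by
  set r : ℝ := (d : ℝ) + 1
  have hr : 0 ≤ r := by positivity
  have hg1 : ∀ x : EuclideanSpace ℝ (Fin d), (1 + ‖x‖) ^ (-r) ≤ 1 := fun x =>
    Real.rpow_le_one_of_one_le_of_nonpos (by linarith [norm_nonneg x]) (by linarith)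
  rcases eq_or_ne q ∞ with rfl | hqt
  · refine ⟨1, one_pos, fun L hL => ?_⟩
    rw [ENNReal.ofReal_one, one_mul, eLpNorm_exponent_top, eLpNorm_exponent_top]
    set M := eLpNormEssSup L (volume.restrict (unitCell d))
    refine eLpNormEssSup_le_of_ae_enorm_bound ?_
    have hM : ∀ᵐ x ∂volume, ‖L x‖ₑ ≤ M := by
      have hQ : ∀ᵐ x ∂volume.restrict (unitCell d), ‖L x‖ₑ ≤ M := enorm_ae_le_eLpNormEssSup _ _
      rw [ae_iff, Measure.restrict_apply' measurableSet_unitCell] at hQ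
      refine ae_iff.2 (measure_mono_null (t := ⋃ k : Fin d → ℤ, (fun x => x + -zVec k) ⁻¹'
        ({x | ¬ ‖L x‖ₑ ≤ M} ∩ unitCell d)) (fun x hx => ?_) (measure_iUnion_null fun k => ?_))
      · refine Set.mem_iUnion.2 ⟨floorVec x, ?_, ?_⟩
        · have := hL (floorVec x) (x + -zVec (floorVec x))
          rw [neg_add_cancel_right] at this
          change ¬ ‖L (x + -zVec (floorVec x))‖ₑ ≤ M
          rwa [← this]
        · change x + -zVec (floorVec x) ∈ unitCell d
          rw [← sub_eq_add_neg]
          exact sub_floorVec_mem x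
      · rwa [measure_preimage_add_right]
    filter_upwards [hM] with x hx
    refine le_trans ?_ hx
    rw [enorm_mul, enorm_norm]
    refine mul_le_of_le_one_left' ?_
    rw [Real.enorm_eq_ofReal (by positivity)]
    exact ENNReal.ofReal_le_one.2 (hg1 x)
  · have hq0 : q ≠ 0 := (zero_lt_one.trans_le hq).ne'
    have hq1 : 1 ≤ q.toReal := by
      rwa [← ENNReal.toReal_one, ENNReal.toReal_le_toReal ENNReal.one_ne_top hqt]
    have hqpos : 0 < q.toReal := by linarith
    set S : ℝ≥0∞ := ENNReal.ofReal ((1 + (d : ℝ)) ^ r) *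
      ∑' k : Fin d → ℤ, ENNReal.ofReal ((1 + ‖zVec k‖) ^ (-r))
    have hS : S ≠ ∞ := (ENNReal.mul_lt_top ENNReal.ofReal_lt_top
      tsum_one_add_norm_zVec_lt_top).ne
    refine ⟨(S ^ (1 / q.toReal)).toReal + 1, by positivity, fun L hL => ?_⟩
    have hSC : S ^ (1 / q.toReal) ≤ ENNReal.ofReal ((S ^ (1 / q.toReal)).toReal + 1) := by
      rw [← ENNReal.ofReal_toReal (ENNReal.rpow_ne_top_of_nonneg (by positivity) hS :
        S ^ (1 / q.toReal) ≠ ∞)]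
      exact ENNReal.ofReal_le_ofReal (by simp)
    refine le_trans ?_ (mul_le_mul_left hSC _)
    rw [eLpNorm_eq_lintegral_rpow_enorm_toReal hq0 hqt,
      eLpNorm_eq_lintegral_rpow_enorm_toReal hq0 hqt,
      ← ENNReal.mul_rpow_of_nonneg _ _ (by positivity)]
    gcongr
    rw [lintegral_eq_tsum_unitCell]
    simp only [S]
    rw [← ENNReal.tsum_mul_left, ← ENNReal.tsum_mul_right]
    refine ENNReal.tsum_le_tsum fun k => ?_
    rw [← lintegral_const_mul' _ _ (ENNReal.mul_ne_top ENNReal.ofReal_ne_top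
      ENNReal.ofReal_ne_top)]
    refine setLIntegral_mono' measurableSet_unitCell fun u hu => ?_
    rw [hL, enorm_mul, enorm_norm, ENNReal.mul_rpow_of_nonneg _ _ hqpos.le,
      Real.enorm_eq_ofReal (by positivity)]
    gcongr
    calc ENNReal.ofReal ((1 + ‖u + zVec k‖) ^ (-r)) ^ q.toReal
        ≤ ENNReal.ofReal ((1 + ‖u + zVec k‖) ^ (-r)) ^ (1 : ℝ) :=
          ENNReal.rpow_le_rpow_of_exponent_ge (ENNReal.ofReal_le_one.2 (hg1 _)) hq1
      _ ≤ _ := by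
          rw [ENNReal.rpow_one, ← ENNReal.ofReal_mul (by positivity)]
          refine ENNReal.ofReal_le_ofReal
            ((one_add_norm_rpow_neg_le (u + zVec k) (-u) hr).trans ?_)
          rw [norm_neg, add_neg_cancel_comm]
          gcongr
          exact norm_le_of_mem_unitCell hu

end Periodic

section BrokenPow

variable {A : ℝ × ℝ}

lemma brokenWeight_eq {d : ℕ} (A : ℝ × ℝ) (x : EuclideanSpace ℝ (Fin d)) :
    brokenWeight A x = brokenPow A ‖x‖ := rfl

lemma brokenPow_nonneg (A : ℝ × ℝ) {r : ℝ} (hr : 0 ≤ r) : 0 ≤ brokenPow A r := by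
  unfold brokenPow; split_ifs <;> positivity

lemma brokenPow_mono (h1 : 0 ≤ A.1) (h2 : 0 ≤ A.2) {r s : ℝ} (hr : 0 ≤ r) (hrs : r ≤ s) :
    brokenPow A r ≤ brokenPow A s := by
  unfold brokenPow
  split_ifs with hr1 hs1 hs1
  · exact Real.rpow_le_rpow hr hrs h1
  · exact (Real.rpow_le_one hr hr1.le h1).trans (Real.one_le_rpow (not_lt.1 hs1) h2)
  · linarith
  · exact Real.rpow_le_rpow hr hrs h2

lemma brokenPow_mul_le (h1 : 0 ≤ A.1) (h2 : 0 ≤ A.2) {t s : ℝ} (ht : 0 < t) (hs : 1 ≤ s) :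
    brokenPow A (t * s) ≤ s ^ (A.1 + A.2) * brokenPow A t := by
  have hs0 : 0 < s := by linarith
  have hs1 : 1 ≤ s ^ A.1 := Real.one_le_rpow hs h1
  have hs2 : 1 ≤ s ^ A.2 := Real.one_le_rpow hs h2
  rw [Real.rpow_add hs0]
  unfold brokenPow
  split_ifs with hts ht1 ht1
  · rw [Real.mul_rpow ht.le hs0.le]
    have : 0 ≤ t ^ A.1 * s ^ A.1 := by positivity
    nlinarith
  · nlinarith
  · rw [Real.mul_rpow ht.le hs0.le]
    have h3 : t ^ A.2 ≤ 1 := Real.rpow_le_one ht.le ht1.le h2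
    have h4 : 1 ≤ (t * s) ^ A.1 := Real.one_le_rpow (not_lt.1 hts) h1
    rw [Real.mul_rpow ht.le hs0.le] at h4
    calc t ^ A.2 * s ^ A.2 ≤ 1 * s ^ A.2 := by gcongr
      _ ≤ (t ^ A.1 * s ^ A.1) * s ^ A.2 := by gcongr
      _ = _ := by ring
  · rw [Real.mul_rpow ht.le hs0.le]
    have : 0 ≤ t ^ A.2 * s ^ A.2 := by positivity
    nlinarith

lemma brokenPow_add (A : ℝ × ℝ) (r : ℝ) {t : ℝ} (ht : 0 < t) :
    brokenPow (A.1 + r, A.2 + r) t = t ^ r * brokenPow A t := by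
  unfold brokenPow
  split_ifs <;> rw [Real.rpow_add ht, mul_comm]

end BrokenPow

section LatticeSum

variable {d : ℕ}

lemma latticeSum_eq_sum {c : (Fin d → ℤ) → ℝ} (hc : (Function.support c).Finite)
    (y : EuclideanSpace ℝ (Fin d)) :
    latticeSum c y = ∑ n ∈ hc.toFinset, (c n : ℂ) *
      Complex.exp (2 * (π : ℂ) * Complex.I * (∑ i, (y i : ℂ) * (n i : ℂ))) := by
  refine finsum_eq_sum_of_support_subset _ fun n hn => ?_
  simp only [Set.Finite.coe_toFinset, Function.mem_support] at hn ⊢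
  contrapose! hn
  simp [hn]

lemma latticeSum_add_zVec (c : (Fin d → ℤ) → ℝ) (k : Fin d → ℤ)
    (y : EuclideanSpace ℝ (Fin d)) : latticeSum c (y + zVec k) = latticeSum c y := by
  unfold latticeSum
  refine finsum_congr fun n => ?_
  congr 1
  rw [Complex.exp_eq_exp_iff_exists_int]
  refine ⟨∑ i, k i * n i, ?_⟩
  simp only [PiLp.add_apply, zVec_apply]
  push_cast
  simp only [add_mul, Finset.sum_add_distrib]
  ring

/-- The Fourier transform of a modulated function is a superposition of translates. -/
lemma fourier_mul_latticeSum (φ : SchwartzMap (EuclideanSpace ℝ (Fin d)) ℂ)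
    {c : (Fin d → ℤ) → ℝ} (hc : (Function.support c).Finite) (η : EuclideanSpace ℝ (Fin d)) :
    𝓕 (fun y => φ y * latticeSum c y) η =
      ∑ n ∈ hc.toFinset, (c n : ℂ) * 𝓕 (⇑φ) (η - zVec n) := by
  have key : ∀ (n : Fin d → ℤ) (y : EuclideanSpace ℝ (Fin d)),
      Complex.exp (↑(-2 * π * inner ℝ y η) * Complex.I) •
        (φ y * ((c n : ℂ) * Complex.exp (2 * (π : ℂ) * Complex.I *
          (∑ i, (y i : ℂ) * (n i : ℂ))))) =
      (c n : ℂ) * (Complex.exp (↑(-2 * π * inner ℝ y (η - zVec n)) * Complex.I) • φ y) := by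
    intro n y
    have h : Complex.exp (↑(-2 * π * inner ℝ y (η - zVec n)) * Complex.I) =
        Complex.exp (↑(-2 * π * inner ℝ y η) * Complex.I) *
          Complex.exp (2 * (π : ℂ) * Complex.I * (∑ i, (y i : ℂ) * (n i : ℂ))) := by
      rw [← Complex.exp_add, inner_sub_right]
      congr 1
      have : inner ℝ y (zVec n) = ∑ i, y i * n i := by
        simp [PiLp.inner_apply, mul_comm]
      rw [this]
      push_cast
      ring
    rw [h]
    simp only [smul_eq_mul]
    ring
  have hsum : ∀ y, Complex.exp (↑(-2 * π * inner ℝ y η) * Complex.I) • (φ y * latticeSum c y) =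
      ∑ n ∈ hc.toFinset,
        (c n : ℂ) * (Complex.exp (↑(-2 * π * inner ℝ y (η - zVec n)) * Complex.I) • φ y) := by
    intro y
    rw [latticeSum_eq_sum hc, Finset.mul_sum, Finset.smul_sum]
    exact Finset.sum_congr rfl fun n _ => key n y
  rw [Real.fourier_eq']
  simp_rw [hsum]
  rw [integral_finsetSum _ fun n _ => ?_]
  · refine Finset.sum_congr rfl fun n _ => ?_
    rw [integral_const_mul, Real.fourier_eq']
  · refine Integrable.const_mul ?_ _
    refine (integrable_norm_iff ?_).1 ?_
    · exact (Continuous.aestronglyMeasurable (by fun_prop))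
    · simp_rw [norm_smul, Complex.norm_exp_ofReal_mul_I, one_mul]
      exact φ.integrable.norm

lemma fourier_comp_inv_smul (g : EuclideanSpace ℝ (Fin d) → ℂ) {t : ℝ} (ht : 0 < t)
    (ξ : EuclideanSpace ℝ (Fin d)) :
    𝓕 (fun x => g (t⁻¹ • x)) ξ = ((t ^ d : ℝ) : ℂ) * 𝓕 g (t • ξ) := by
  rw [Real.fourier_eq', Real.fourier_eq']
  have h := Measure.integral_comp_inv_smul (volume : Measure (EuclideanSpace ℝ (Fin d)))
    (fun v => Complex.exp (↑(-2 * π * inner ℝ v (t • ξ)) * Complex.I) • g v) t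
  rw [finrank_euclideanSpace_fin, abs_of_pos (by positivity)] at h
  rw [← Complex.real_smul, ← h]
  refine integral_congr_ae (Filter.Eventually.of_forall fun x => ?_)
  simp only [inner_smul_left, inner_smul_right]
  congr 5
  simp [ht.ne']

end LatticeSum

section UnitCubeSupport

variable {d : ℕ}

/-- A continuous function supported in the closed unit cube vanishes off the open one. -/
lemma eq_zero_of_notMem_Ioo {F : EuclideanSpace ℝ (Fin d) → ℂ} (hF : Continuous F)
    (hsupp : Function.support F ⊆ {ξ | ∀ i, ξ i ∈ Set.Icc (0:ℝ) 1})
    {ξ : EuclideanSpace ℝ (Fin d)} {i : Fin d} (hi : ξ i ∉ Set.Ioo (0 : ℝ) 1) : F ξ = 0 := by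
  by_contra hne
  have hopen : IsOpen (Function.support F) := isOpen_ne_fun hF continuous_const
  have hev : ∀ᶠ s : ℝ in nhds 0, ξ + s • EuclideanSpace.single i (1 : ℝ) ∈ Function.support F := by
    have hc : Continuous fun s : ℝ => ξ + s • EuclideanSpace.single i (1 : ℝ) := by fun_prop
    refine hc.continuousAt.eventually_mem (hopen.mem_nhds ?_)
    simpa using hne
  obtain ⟨ε, hε, h⟩ := Metric.eventually_nhds_iff.1 hev
  have h1 := hsupp (h (y := ε / 2) (by simpa [abs_of_pos hε] using hε)) i
  have h2 := hsupp (h (y := -(ε / 2)) (by simpa [abs_of_pos hε] using hε)) i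
  simp at h1 h2
  exact hi ⟨by linarith, by linarith⟩

/-- On each lattice cell only one translate contributes. -/
lemma fourier_mul_latticeSum_eq (φ : SchwartzMap (EuclideanSpace ℝ (Fin d)) ℂ)
    (hF : Continuous (𝓕 (⇑φ)))
    (hsupp : Function.support (𝓕 (⇑φ)) ⊆ {ξ | ∀ i, ξ i ∈ Set.Icc (0:ℝ) 1})
    {c : (Fin d → ℤ) → ℝ} (hc : (Function.support c).Finite) (η : EuclideanSpace ℝ (Fin d)) :
    𝓕 (fun y => φ y * latticeSum c y) η =
      (c (floorVec η) : ℂ) * 𝓕 (⇑φ) (η - zVec (floorVec η)) := by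
  rw [fourier_mul_latticeSum φ hc]
  refine Finset.sum_eq_single _ (fun n _ hn => ?_) fun h => ?_
  · obtain ⟨i, hi⟩ : ∃ i, floorVec η i ≠ n i := by
      by_contra! h
      exact hn (funext h).symm
    rw [eq_zero_of_notMem_Ioo hF hsupp (i := i), mul_zero]
    rintro ⟨h0, h1⟩
    simp only [PiLp.sub_apply, zVec_apply] at h0 h1
    exact hi (Int.floor_eq_iff.2 ⟨by linarith, by linarith⟩)
  · have : c (floorVec η) = 0 := by simpa using h
    simp [this]

/-- Points well inside a lattice cell have norm comparable to that of the lattice point. -/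
lemma one_add_zNorm_le (hd : 1 ≤ d) {δ : ℝ} (hδ : 0 < δ) {n : Fin d → ℤ}
    {u : EuclideanSpace ℝ (Fin d)} (hu : ∀ i, δ ≤ u i ∧ u i ≤ 1 - δ) :
    1 + zNorm n ≤ 4 / δ * ‖u + zVec n‖ := by
  have hcoord : ∀ i, (δ / 2) ^ 2 * (1 + (n i : ℝ) ^ 2) ≤ ‖(u + zVec n) i‖ ^ 2 := by
    intro i
    obtain ⟨h1, h2⟩ := hu i
    rw [Real.norm_eq_abs, sq_abs, PiLp.add_apply, zVec_apply]
    rcases le_or_gt 0 (n i) with hn | hn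
    · have hn' : (0 : ℝ) ≤ n i := by exact_mod_cast hn
      have h3 : (δ / 2) * (1 + n i) ≤ u i + n i := by nlinarith
      have h4 : 0 ≤ (δ / 2) * (1 + n i) := by positivity
      nlinarith [mul_nonneg hn' (sq_nonneg δ)]
    · have hn' : (n i : ℝ) ≤ -1 := by exact_mod_cast Int.le_sub_one_of_lt hn
      have h3 : (δ / 2) * (1 - n i) ≤ -(u i + n i) := by nlinarith
      have h4 : 0 ≤ (δ / 2) * (1 - n i) := by
        have : (0 : ℝ) ≤ 1 - n i := by linarith
        positivity
      have hn'' : (0 : ℝ) ≤ -n i := by linarith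
      nlinarith [mul_nonneg hn'' (sq_nonneg δ)]
  have hsum : (δ / 2) ^ 2 * (1 + zNorm n ^ 2) ≤ ‖u + zVec n‖ ^ 2 := by
    rw [EuclideanSpace.norm_sq_eq, zNorm, Real.sq_sqrt (by positivity)]
    refine le_trans ?_ (Finset.sum_le_sum fun i _ => hcoord i)
    rw [← Finset.mul_sum, Finset.sum_add_distrib]
    have : (1 : ℝ) ≤ d := by exact_mod_cast hd
    gcongr
    simpa
  have h5 : ((δ / 4) * (1 + zNorm n)) ^ 2 ≤ ‖u + zVec n‖ ^ 2 := by
    refine le_trans ?_ hsum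
    nlinarith [sq_nonneg (zNorm n - 1), sq_nonneg δ,
      mul_nonneg (sq_nonneg δ) (sq_nonneg (zNorm n - 1)),
      mul_nonneg (sq_nonneg δ) (sq_nonneg (zNorm n))]
  have h6 := (le_abs_self _).trans (abs_le_of_sq_le_sq h5 (norm_nonneg _))
  rw [div_mul_eq_mul_div, le_div_iff₀ hδ]
  linarith

lemma norm_add_zVec_le {n : Fin d → ℤ} {u : EuclideanSpace ℝ (Fin d)} (hu : u ∈ unitCell d) :
    ‖u + zVec n‖ ≤ (d + 1) * (1 + zNorm n) := by
  have h1 := norm_add_le u (zVec n)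
  have h2 := norm_le_of_mem_unitCell hu
  rw [norm_zVec] at h1
  nlinarith [zNorm_nonneg n, mul_nonneg (Nat.cast_nonneg (α := ℝ) d) (zNorm_nonneg n)]

end UnitCubeSupport

section Bounds

variable {d : ℕ}

lemma ENNReal.ofReal_div_mul_le {v C : ℝ} (hC : 0 < C) {X Y : ℝ≥0∞}
    (h : ENNReal.ofReal v * X ≤ ENNReal.ofReal C * Y) : ENNReal.ofReal (v / C) * X ≤ Y := by
  have hC' : ENNReal.ofReal C ≠ 0 := by simpa using hC
  rw [ENNReal.ofReal_div_of_pos hC, ENNReal.mul_comm_div, mul_comm, ← ENNReal.mul_div_right_comm,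
    mul_comm]
  exact ENNReal.div_le_of_le_mul' h

lemma eLpNorm_physical_eq (A : ℝ × ℝ) (q : ℝ≥0∞) (g : EuclideanSpace ℝ (Fin d) → ℂ) {t : ℝ}
    (ht : 0 < t) :
    eLpNorm (fun x => brokenWeight A x * ‖g (t⁻¹ • x)‖) q volume =
      ENNReal.ofReal (t ^ ((d : ℝ) * (1 / q).toReal)) *
        eLpNorm (fun y => brokenPow A (t * ‖y‖) * ‖g y‖) q volume := by
  have h := eLpNorm_comp_smul q (fun y => brokenPow A (t * ‖y‖) * ‖g y‖) (inv_pos.2 ht)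
  rw [Real.inv_rpow ht.le, Real.rpow_neg ht.le, inv_inv] at h
  rw [← h]
  congr 1
  ext x
  rw [brokenWeight_eq, norm_smul, norm_inv, Real.norm_of_nonneg ht.le,
    mul_inv_cancel_left₀ ht.ne']

lemma eLpNorm_frequency_eq (B : ℝ × ℝ) (p : ℝ≥0∞) (g : EuclideanSpace ℝ (Fin d) → ℂ) {t : ℝ}
    (ht : 0 < t) :
    eLpNorm (fun ξ => brokenWeight B ξ * ‖𝓕 (fun x => g (t⁻¹ • x)) ξ‖) p volume =
      ENNReal.ofReal (t ^ ((d : ℝ) * (1 - (1 / p).toReal))) *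
        eLpNorm (fun η => brokenPow B (‖η‖ / t) * ‖𝓕 g η‖) p volume := by
  have h := eLpNorm_comp_smul p (fun η => brokenPow B (‖η‖ / t) * ‖𝓕 g η‖) ht
  have hfun : (fun ξ => brokenWeight B ξ * ‖𝓕 (fun x => g (t⁻¹ • x)) ξ‖) =
      (t ^ d : ℝ) • fun ξ => brokenPow B (‖t • ξ‖ / t) * ‖𝓕 g (t • ξ)‖ := by
    ext ξ
    rw [fourier_comp_inv_smul g ht, brokenWeight_eq, norm_mul, Complex.norm_real, norm_pow,
      Real.norm_of_nonneg ht.le, Pi.smul_apply, smul_eq_mul, norm_smul, Real.norm_of_nonneg ht.le,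
      mul_div_cancel_left₀ _ ht.ne']
    ring
  rw [hfun, eLpNorm_const_smul, h, ← mul_assoc, Real.enorm_eq_ofReal (by positivity),
    ← ENNReal.ofReal_mul (by positivity), ← Real.rpow_natCast, ← Real.rpow_add ht, mul_one_sub,
    sub_eq_add_neg]

lemma exists_schwartz_weight_bound (φ : SchwartzMap (EuclideanSpace ℝ (Fin d)) ℂ)
    {A : ℝ × ℝ} (hA1 : 0 ≤ A.1) (hA2 : 0 ≤ A.2) :
    ∃ C : ℝ, 0 < C ∧ ∀ t : ℝ, 0 < t → ∀ y : EuclideanSpace ℝ (Fin d),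
      brokenPow A (t * ‖y‖) * ‖φ y‖ ≤
        C * brokenPow A t * (1 + ‖y‖) ^ (-((d : ℝ) + 1)) := by
  obtain ⟨N, hN⟩ := exists_nat_ge (A.1 + A.2 + ((d : ℝ) + 1))
  set C : ℝ := 2 ^ N * ((Finset.Iic (N, 0)).sup fun m => SchwartzMap.seminorm ℝ m.1 m.2) φ
  have hφ : ∀ y, (1 + ‖y‖) ^ N * ‖φ y‖ ≤ C := fun y => by
    simpa using SchwartzMap.one_add_le_sup_seminorm_apply (𝕜 := ℝ) (m := (N, 0)) le_rfl le_rfl φ y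
  have hC : 0 ≤ C := le_trans (by positivity) (hφ 0)
  refine ⟨C + 1, by positivity, fun t ht y => ?_⟩
  have hy : 1 ≤ 1 + ‖y‖ := by linarith [norm_nonneg y]
  have hy0 : 0 < 1 + ‖y‖ := by linarith
  have h1 : brokenPow A (t * ‖y‖) ≤ (1 + ‖y‖) ^ (A.1 + A.2) * brokenPow A t :=
    (brokenPow_mono hA1 hA2 (by positivity) (by gcongr; linarith)).trans
      (brokenPow_mul_le hA1 hA2 ht hy)
  have h2 : (1 + ‖y‖) ^ (A.1 + A.2) * ‖φ y‖ ≤ C * (1 + ‖y‖) ^ (-((d : ℝ) + 1)) := by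
    rw [Real.rpow_neg hy0.le, ← div_eq_mul_inv, le_div_iff₀ (by positivity), mul_right_comm,
      ← Real.rpow_add hy0]
    refine le_trans ?_ (hφ y)
    rw [← Real.rpow_natCast]
    gcongr
  have hb := brokenPow_nonneg A ht.le
  calc brokenPow A (t * ‖y‖) * ‖φ y‖
      ≤ ((1 + ‖y‖) ^ (A.1 + A.2) * brokenPow A t) * ‖φ y‖ := by gcongr
    _ = brokenPow A t * ((1 + ‖y‖) ^ (A.1 + A.2) * ‖φ y‖) := by ring
    _ ≤ brokenPow A t * (C * (1 + ‖y‖) ^ (-((d : ℝ) + 1))) := by gcongr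
    _ = C * brokenPow A t * (1 + ‖y‖) ^ (-((d : ℝ) + 1)) := by ring
    _ ≤ _ := by gcongr; linarith

lemma exists_physical_upper (φ : SchwartzMap (EuclideanSpace ℝ (Fin d)) ℂ)
    {A : ℝ × ℝ} (hA1 : 0 ≤ A.1) (hA2 : 0 ≤ A.2) {q : ℝ≥0∞} (hq : 1 ≤ q) :
    ∃ C : ℝ, 0 < C ∧ ∀ t : ℝ, 0 < t → ∀ c : (Fin d → ℤ) → ℝ,
      eLpNorm (fun y => brokenPow A (t * ‖y‖) * ‖φ y * latticeSum c y‖) q volume ≤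
        ENNReal.ofReal (C * brokenPow A t) * eLpNorm (latticeSum c) q
          (volume.restrict {x : EuclideanSpace ℝ (Fin d) | ∀ i, x i ∈ Set.Icc (0:ℝ) 1}) := by
  obtain ⟨C₁, hC₁, h₁⟩ := exists_schwartz_weight_bound φ hA1 hA2
  obtain ⟨C₂, hC₂, h₂⟩ := exists_eLpNorm_mul_periodic_le (d := d) q hq
  refine ⟨C₁ * C₂, by positivity, fun t ht c => ?_⟩
  have hb := brokenPow_nonneg A ht.le
  calc eLpNorm (fun y => brokenPow A (t * ‖y‖) * ‖φ y * latticeSum c y‖) q volume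
      ≤ ENNReal.ofReal (C₁ * brokenPow A t) *
          eLpNorm (fun y => (1 + ‖y‖) ^ (-((d : ℝ) + 1)) * ‖latticeSum c y‖) q volume := by
        refine eLpNorm_le_mul_eLpNorm_of_ae_le_mul (Filter.Eventually.of_forall fun y => ?_) q
        have hby := brokenPow_nonneg A (mul_nonneg ht.le (norm_nonneg y))
        rw [Real.norm_of_nonneg (by positivity), Real.norm_of_nonneg (by positivity), norm_mul,
          ← mul_assoc, ← mul_assoc]
        exact mul_le_mul_of_nonneg_right (h₁ t ht y) (norm_nonneg _)
    _ ≤ ENNReal.ofReal (C₁ * brokenPow A t) * (ENNReal.ofReal C₂ * eLpNorm (latticeSum c) q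
          (volume.restrict (unitCell d))) := by
        gcongr
        exact h₂ _ (latticeSum_add_zVec c)
    _ ≤ ENNReal.ofReal (C₁ * brokenPow A t) * (ENNReal.ofReal C₂ * eLpNorm (latticeSum c) q
          (volume.restrict {x : EuclideanSpace ℝ (Fin d) | ∀ i, x i ∈ Set.Icc (0:ℝ) 1})) := by
        gcongr
        exact fun x hx i => Set.Ico_subset_Icc_self (hx i)
    _ = _ := by
        rw [← mul_assoc, ← ENNReal.ofReal_mul (by positivity)]
        ring_nf

lemma eLpNorm_latticeSum_translate (q : ℝ≥0∞) (c : (Fin d → ℤ) → ℝ) :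
    eLpNorm (latticeSum c) q
        (volume.restrict {x : EuclideanSpace ℝ (Fin d) | ∀ i, x i ∈ Set.Icc (0:ℝ) 1}) =
      eLpNorm (latticeSum c) q
        (volume.restrict {x : EuclideanSpace ℝ (Fin d) | ∀ i, x i ∈ Set.Icc (1:ℝ) 2}) := by
  set v : EuclideanSpace ℝ (Fin d) := zVec fun _ => 1
  have hmp := (measurePreserving_add_right volume v).restrict_preimage_emb
    (measurableEmbedding_addRight v)
    {x : EuclideanSpace ℝ (Fin d) | ∀ i, x i ∈ Set.Icc (1:ℝ) 2}
  have hset : (fun x => x + v) ⁻¹' {x : EuclideanSpace ℝ (Fin d) | ∀ i, x i ∈ Set.Icc (1:ℝ) 2} =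
      {x : EuclideanSpace ℝ (Fin d) | ∀ i, x i ∈ Set.Icc (0:ℝ) 1} := by
    ext x
    refine forall_congr' fun i => ?_
    simp only [v, PiLp.add_apply, zVec_apply, Set.mem_Icc, Int.cast_one]
    constructor <;> rintro ⟨h1, h2⟩ <;> constructor <;> linarith
  rw [hset] at hmp
  rw [← hmp.map_eq, (measurableEmbedding_addRight v).eLpNorm_map_measure]
  congr 1
  ext x
  exact (latticeSum_add_zVec c _ x).symm

lemma exists_physical_lower (hd : 1 ≤ d) (φ : SchwartzMap (EuclideanSpace ℝ (Fin d)) ℂ)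
    (hφ : ∀ x : EuclideanSpace ℝ (Fin d), (∀ i, x i ∈ Set.Icc (1:ℝ) 2) → φ x ≠ 0)
    {A : ℝ × ℝ} (hA1 : 0 ≤ A.1) (hA2 : 0 ≤ A.2) (q : ℝ≥0∞) :
    ∃ m : ℝ, 0 < m ∧ ∀ t : ℝ, 0 < t → ∀ c : (Fin d → ℤ) → ℝ,
      ENNReal.ofReal (m * brokenPow A t) * eLpNorm (latticeSum c) q
          (volume.restrict {x : EuclideanSpace ℝ (Fin d) | ∀ i, x i ∈ Set.Icc (0:ℝ) 1}) ≤
        eLpNorm (fun y => brokenPow A (t * ‖y‖) * ‖φ y * latticeSum c y‖) q volume := by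
  set K : Set (EuclideanSpace ℝ (Fin d)) := {x | ∀ i, x i ∈ Set.Icc (1:ℝ) 2}
  have hKim : K = WithLp.toLp 2 '' Set.pi Set.univ fun _ : Fin d => Set.Icc (1:ℝ) 2 := by
    ext x
    constructor
    · exact fun hx => ⟨x.ofLp, fun i _ => hx i, rfl⟩
    · rintro ⟨y, hy, rfl⟩ i
      exact hy i trivial
  have hKc : IsCompact K := by
    rw [hKim]
    exact (isCompact_univ_pi fun _ => isCompact_Icc).image (PiLp.continuous_toLp 2 _)
  have hKne : K.Nonempty := ⟨WithLp.toLp 2 fun _ => 1, fun i => by simp⟩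
  obtain ⟨x₀, hx₀, hmin⟩ := hKc.exists_isMinOn hKne φ.continuous.norm.continuousOn
  refine ⟨‖φ x₀‖, norm_pos_iff.2 (hφ x₀ hx₀), fun t ht c => ?_⟩
  have hb := brokenPow_nonneg A ht.le
  rw [eLpNorm_latticeSum_translate]
  have hpt : ∀ y ∈ K, ‖((‖φ x₀‖ * brokenPow A t) • latticeSum c) y‖ ≤
      ‖brokenPow A (t * ‖y‖) * ‖φ y * latticeSum c y‖‖ := by
    intro y hy
    have h1 : 1 ≤ ‖y‖ := by
      have h2 := PiLp.norm_apply_le y ⟨0, hd⟩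
      exact ((hy ⟨0, hd⟩).1.trans (le_abs_self _)).trans h2
    have h3 : brokenPow A t ≤ brokenPow A (t * ‖y‖) :=
      brokenPow_mono hA1 hA2 ht.le (le_mul_of_one_le_right ht.le h1)
    have h4 : ‖φ x₀‖ ≤ ‖φ y‖ := hmin hy
    rw [Pi.smul_apply, norm_smul, Real.norm_of_nonneg (by positivity),
      Real.norm_of_nonneg (mul_nonneg (hb.trans h3) (norm_nonneg _)), norm_mul, ← mul_assoc,
      mul_comm ‖φ x₀‖]
    gcongr
    exact hb.trans h3
  calc _ = eLpNorm ((‖φ x₀‖ * brokenPow A t) • latticeSum c) q (volume.restrict K) := by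
        rw [eLpNorm_const_smul, Real.enorm_eq_ofReal (by positivity)]
    _ ≤ eLpNorm (fun y => brokenPow A (t * ‖y‖) * ‖φ y * latticeSum c y‖) q
          (volume.restrict K) :=
        eLpNorm_mono_ae ((ae_restrict_iff' hKc.measurableSet).2 (Filter.Eventually.of_forall hpt))
    _ ≤ _ := eLpNorm_mono_measure _ Measure.restrict_le_self

lemma exists_frequency_upper (φ : SchwartzMap (EuclideanSpace ℝ (Fin d)) ℂ)
    (hF : Continuous (𝓕 (⇑φ)))
    (hsupp : Function.support (𝓕 (⇑φ)) ⊆ {ξ | ∀ i, ξ i ∈ Set.Icc (0:ℝ) 1})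
    {B : ℝ × ℝ} (hB1 : 0 ≤ B.1) (hB2 : 0 ≤ B.2) (p : ℝ≥0∞) :
    ∃ C : ℝ, 0 < C ∧ ∀ t : ℝ, 0 < t → ∀ c : (Fin d → ℤ) → ℝ, (Function.support c).Finite →
      eLpNorm (fun η => brokenPow B (‖η‖ / t) * ‖𝓕 (fun y => φ y * latticeSum c y) η‖) p volume ≤
        ENNReal.ofReal C * eLpNorm (fun n : Fin d → ℤ =>
          c n * brokenPow B ((1 + zNorm n) / t)) p Measure.count := by
  set M : ℝ := ∫ v, ‖φ v‖
  have hM : ∀ ξ, ‖𝓕 (⇑φ) ξ‖ ≤ M := fun ξ =>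
    VectorFourier.norm_fourierIntegral_le_integral_norm _ _ _ _ _
  have hM0 : 0 ≤ M := integral_nonneg fun v => norm_nonneg _
  set K : ℝ := ((d : ℝ) + 1) ^ (B.1 + B.2)
  refine ⟨K * (M + 1), by positivity, fun t ht c hc => ?_⟩
  refine eLpNorm_le_count p fun η => ?_
  set n := floorVec η
  set u := η - zVec n
  have hη : η = u + zVec n := (sub_add_cancel _ _).symm
  have hz := zNorm_nonneg n
  have hpos : 0 < (1 + zNorm n) / t := by positivity
  have h1 : brokenPow B (‖η‖ / t) ≤ K * brokenPow B ((1 + zNorm n) / t) := by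
    refine le_trans (brokenPow_mono hB1 hB2 (by positivity) ?_)
      (brokenPow_mul_le hB1 hB2 hpos (s := (d : ℝ) + 1) (by simp))
    rw [div_mul_eq_mul_div, mul_comm, hη]
    gcongr
    exact norm_add_zVec_le (sub_floorVec_mem η)
  have hb := brokenPow_nonneg B hpos.le
  have hb' := brokenPow_nonneg B (div_nonneg (norm_nonneg η) ht.le)
  rw [fourier_mul_latticeSum_eq φ hF hsupp hc, norm_mul, norm_norm, norm_mul, Complex.norm_real,
    norm_mul (c n), Real.norm_of_nonneg hb, Real.norm_of_nonneg hb']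
  calc _ ≤ (K * brokenPow B ((1 + zNorm n) / t)) * (‖c n‖ * (M + 1)) := by
        gcongr
        exact (hM _).trans (by linarith)
    _ = _ := by ring

lemma exists_frequency_lower (hd : 1 ≤ d) (φ : SchwartzMap (EuclideanSpace ℝ (Fin d)) ℂ)
    (hφ : φ ≠ 0) (hF : Continuous (𝓕 (⇑φ)))
    (hsupp : Function.support (𝓕 (⇑φ)) ⊆ {ξ | ∀ i, ξ i ∈ Set.Icc (0:ℝ) 1})
    {B : ℝ × ℝ} (hB1 : 0 ≤ B.1) (hB2 : 0 ≤ B.2) (p : ℝ≥0∞) :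
    ∃ m : ℝ, 0 < m ∧ ∀ t : ℝ, 0 < t → ∀ c : (Fin d → ℤ) → ℝ, (Function.support c).Finite →
      ENNReal.ofReal m * eLpNorm (fun n : Fin d → ℤ =>
          c n * brokenPow B ((1 + zNorm n) / t)) p Measure.count ≤
        eLpNorm (fun η => brokenPow B (‖η‖ / t) * ‖𝓕 (fun y => φ y * latticeSum c y) η‖)
          p volume := by
  obtain ⟨u₀, hu₀⟩ : ∃ u₀, 𝓕 (⇑φ) u₀ ≠ 0 := by
    by_contra! h
    have h0 : 𝓕 φ = 0 := by
      ext ξ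
      simpa [SchwartzMap.fourier_coe] using h ξ
    exact hφ ((FourierTransform.fourierEquiv ℂ (SchwartzMap (EuclideanSpace ℝ (Fin d)) ℂ)
      (F := SchwartzMap (EuclideanSpace ℝ (Fin d)) ℂ)).map_eq_zero_iff.1 h0)
  have hu₀i : ∀ i, u₀ i ∈ Set.Ioo (0 : ℝ) 1 := fun i => by
    by_contra h
    exact hu₀ (eq_zero_of_notMem_Ioo hF hsupp h)
  obtain ⟨δ, hδ, hδu⟩ : ∃ δ : ℝ, 0 < δ ∧ ∀ i, δ < u₀ i ∧ u₀ i < 1 - δ := by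
    have hev : ∀ᶠ δ : ℝ in nhdsWithin 0 (Set.Ioi 0), ∀ i, δ < u₀ i ∧ u₀ i < 1 - δ := by
      refine (Filter.eventually_all.2 fun i => ?_).filter_mono nhdsWithin_le_nhds
      filter_upwards [gt_mem_nhds (hu₀i i).1, gt_mem_nhds (sub_pos.2 (hu₀i i).2)] with δ h1 h2
      exact ⟨h1, by linarith⟩
    obtain ⟨δ, h1, h2⟩ := (hev.and self_mem_nhdsWithin).exists
    exact ⟨δ, h2, h1⟩
  set m : ℝ := ‖𝓕 (⇑φ) u₀‖ / 2
  have hm : 0 < m := by positivity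
  set S : Set (EuclideanSpace ℝ (Fin d)) :=
    {u | ∀ i, δ < u i ∧ u i < 1 - δ} ∩ {u | m < ‖𝓕 (⇑φ) u‖}
  have hSo : IsOpen S := by
    refine IsOpen.inter ?_ (isOpen_lt continuous_const hF.norm)
    simp only [Set.ofPred_forall, Set.ofPred_and]
    exact isOpen_iInter_of_finite fun i =>
      (isOpen_lt continuous_const (by fun_prop)).inter (isOpen_lt (by fun_prop) continuous_const)
  have hSQ : S ⊆ unitCell d := fun u hu i =>
    ⟨(hδ.trans (hu.1 i).1).le, (hu.1 i).2.trans (by linarith)⟩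
  have hS0 : volume S ≠ 0 :=
    (hSo.measure_pos volume ⟨u₀, hδu, half_lt_self (norm_pos_iff.2 hu₀)⟩).ne'
  have hSt : volume S ≠ ∞ :=
    ((measure_mono hSQ).trans_lt (by rw [volume_unitCell]; exact ENNReal.one_lt_top)).ne
  set e : ℝ := (1 / p).toReal
  have hvt : volume S ^ e ≠ ∞ := ENNReal.rpow_ne_top_of_nonneg ENNReal.toReal_nonneg hSt
  have hv0 : volume S ^ e ≠ 0 := fun h =>
    (ENNReal.rpow_pos (pos_iff_ne_zero.2 hS0) hSt).ne' h
  set K : ℝ := (4 / δ + 1) ^ (B.1 + B.2)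
  have hK : 0 < K := by positivity
  refine ⟨(volume S ^ e).toReal / (K / m), div_pos (ENNReal.toReal_pos hv0 hvt) (by positivity),
    fun t ht c hc => ENNReal.ofReal_div_mul_le (by positivity) ?_⟩
  rw [ENNReal.ofReal_toReal hvt]
  refine count_le_eLpNorm p hSo.measurableSet hSQ hS0 fun η hηS => ?_
  set n := floorVec η
  have hz := zNorm_nonneg n
  have hpos : 0 < (1 + zNorm n) / t := by positivity
  have hle : 1 + zNorm n ≤ (4 / δ + 1) * ‖η‖ := by
    have h := one_add_zNorm_le hd hδ (n := n) (u := η - zVec n)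
      fun i => ⟨(hηS.1 i).1.le, (hηS.1 i).2.le⟩
    rw [sub_add_cancel] at h
    linarith [norm_nonneg η]
  have hη : 0 < ‖η‖ := by
    by_contra! h
    have : ‖η‖ = 0 := le_antisymm h (norm_nonneg _)
    rw [this] at hle
    linarith
  have h1 : brokenPow B ((1 + zNorm n) / t) ≤ K * brokenPow B (‖η‖ / t) := by
    refine le_trans (brokenPow_mono hB1 hB2 hpos.le ?_)
      (brokenPow_mul_le hB1 hB2 (div_pos hη ht) (s := 4 / δ + 1)
        (le_add_of_nonneg_left (by positivity)))
    rw [div_mul_eq_mul_div, mul_comm ‖η‖]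
    gcongr
  have hb := brokenPow_nonneg B hpos.le
  have hb' := brokenPow_nonneg B (div_nonneg (norm_nonneg η) ht.le)
  have hmS : m ≤ ‖𝓕 (⇑φ) (η - zVec n)‖ := hηS.2.le
  rw [fourier_mul_latticeSum_eq φ hF hsupp hc, norm_mul (c n), norm_mul, norm_norm, norm_mul,
    Complex.norm_real, Real.norm_of_nonneg hb, Real.norm_of_nonneg hb']
  calc ‖c n‖ * brokenPow B ((1 + zNorm n) / t)
      ≤ ‖c n‖ * (K * brokenPow B (‖η‖ / t)) := by gcongr
    _ = K / m * (brokenPow B (‖η‖ / t) * (‖c n‖ * m)) := by field_simp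
    _ ≤ _ := by gcongr

end Bounds

/-- Lemma 3.4: weighted norms of `f_t(x) = φ(x/t) Σ_n c_n e^{2πi⟨x/t,n⟩}` and of its
Fourier transform, with constants uniform in `t` and in the coefficients. -/
theorem dilated_periodization_norms
    (d : ℕ) (hd : 1 ≤ d) (p q : ℝ≥0∞) (hp : 1 ≤ p) (hq : 1 ≤ q)
    (A B : ℝ × ℝ) (hA1 : 0 ≤ A.1) (hA2 : 0 ≤ A.2) (hB1 : 0 ≤ B.1) (hB2 : 0 ≤ B.2)
    (φ : SchwartzMap (EuclideanSpace ℝ (Fin d)) ℂ)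
    (hsmooth : ContDiff ℝ (⊤ : ℕ∞) (𝓕 (⇑φ)))
    (hnonneg : ∀ ξ, 0 ≤ (𝓕 (⇑φ) ξ).re ∧ (𝓕 (⇑φ) ξ).im = 0)
    (hsupp : Function.support (𝓕 (⇑φ)) ⊆ {ξ | ∀ i, ξ i ∈ Set.Icc (0:ℝ) 1})
    (hnonvanish : ∀ x : EuclideanSpace ℝ (Fin d), (∀ i, x i ∈ Set.Icc (1:ℝ) 2) → φ x ≠ 0) :
    ∃ c₀ C₀ : ℝ, 0 < c₀ ∧ 0 < C₀ ∧
      ∀ t : ℝ, 0 < t → ∀ c : (Fin d → ℤ) → ℝ, (Function.support c).Finite →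
        (ENNReal.ofReal (c₀ * brokenPow (A.1 + (d : ℝ) * (1/q).toReal,
              A.2 + (d : ℝ) * (1/q).toReal) t) *
            eLpNorm (latticeSum c) q
              (volume.restrict {x : EuclideanSpace ℝ (Fin d) | ∀ i, x i ∈ Set.Icc (0:ℝ) 1}) ≤
          eLpNorm (fun x => brokenWeight A x *
              ‖φ (t⁻¹ • x) * latticeSum c (t⁻¹ • x)‖) q volume ∧
          eLpNorm (fun x => brokenWeight A x *
              ‖φ (t⁻¹ • x) * latticeSum c (t⁻¹ • x)‖) q volume ≤
            ENNReal.ofReal (C₀ * brokenPow (A.1 + (d : ℝ) * (1/q).toReal,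
                A.2 + (d : ℝ) * (1/q).toReal) t) *
              eLpNorm (latticeSum c) q
                (volume.restrict
                  {x : EuclideanSpace ℝ (Fin d) | ∀ i, x i ∈ Set.Icc (0:ℝ) 1})) ∧
        (ENNReal.ofReal (c₀ * t ^ ((d : ℝ) * (1 - (1/p).toReal))) *
            eLpNorm (fun n : Fin d → ℤ =>
              c n * brokenPow B ((1 + zNorm n) / t)) p Measure.count ≤
          eLpNorm (fun ξ => brokenWeight B ξ *
              ‖𝓕 (fun x => φ (t⁻¹ • x) * latticeSum c (t⁻¹ • x)) ξ‖) p volume ∧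
          eLpNorm (fun ξ => brokenWeight B ξ *
              ‖𝓕 (fun x => φ (t⁻¹ • x) * latticeSum c (t⁻¹ • x)) ξ‖) p volume ≤
            ENNReal.ofReal (C₀ * t ^ ((d : ℝ) * (1 - (1/p).toReal))) *
              eLpNorm (fun n : Fin d → ℤ =>
                c n * brokenPow B ((1 + zNorm n) / t)) p Measure.count) := by
  have hφ : φ ≠ 0 := by
    rintro rfl
    exact hnonvanish (WithLp.toLp 2 fun _ => 1) (fun i => by simp) rfl
  obtain ⟨m₁, hm₁, h₁⟩ := exists_physical_lower hd φ hnonvanish hA1 hA2 q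
  obtain ⟨C₁, hC₁, h₂⟩ := exists_physical_upper φ hA1 hA2 hq
  obtain ⟨m₂, hm₂, h₃⟩ := exists_frequency_lower hd φ hφ hsmooth.continuous hsupp hB1 hB2 p
  obtain ⟨C₂, hC₂, h₄⟩ := exists_frequency_upper φ hsmooth.continuous hsupp hB1 hB2 p
  refine ⟨min m₁ m₂, max C₁ C₂, lt_min hm₁ hm₂, lt_max_of_lt_left hC₁, fun t ht c hc => ?_⟩
  have hb := brokenPow_nonneg A ht.le
  have hphys : ∀ r : ℝ, ENNReal.ofReal (r * brokenPow (A.1 + (d : ℝ) * (1/q).toReal,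
      A.2 + (d : ℝ) * (1/q).toReal) t) = ENNReal.ofReal (t ^ ((d : ℝ) * (1 / q).toReal)) *
        ENNReal.ofReal (r * brokenPow A t) := fun r => by
    rw [brokenPow_add A _ ht, ← ENNReal.ofReal_mul (by positivity)]
    ring_nf
  have hfreq : ∀ r : ℝ, ENNReal.ofReal (r * t ^ ((d : ℝ) * (1 - (1/p).toReal))) =
      ENNReal.ofReal (t ^ ((d : ℝ) * (1 - (1/p).toReal))) * ENNReal.ofReal r := fun r => by
    rw [← ENNReal.ofReal_mul (by positivity), mul_comm]
  rw [eLpNorm_physical_eq A q (fun y => φ y * latticeSum c y) ht,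
    eLpNorm_frequency_eq B p (fun y => φ y * latticeSum c y) ht, hphys, hphys, hfreq, hfreq]
  simp only [mul_assoc]
  refine ⟨⟨?_, ?_⟩, ?_, ?_⟩
  · gcongr
    refine le_trans ?_ (h₁ t ht c)
    gcongr
    exact min_le_left _ _
  · gcongr
    refine (h₂ t ht c).trans ?_
    gcongr
    exact le_max_left _ _
  · gcongr
    refine le_trans ?_ (h₃ t ht c hc)
    gcongr
    exact min_le_right _ _
  · gcongr
    refine (h₄ t ht c hc).trans ?_
    gcongr
    exact le_max_right _ _
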